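/- Let G be a connected graph, let H be a spanning tree of G, and let T be a rooting of H. Then for every T-monotone priority function p on V(G), Ind(G,p) = Ind(H,p). -/

import Mathlib

/-- A rooted tree on a node set `α`, given by its root and parent function
(the root is its own parent, and every node reaches the root by iterating `parent`). -/
structure RTree (α : Type*) where
  root : α
  parent : α → α
  parent_root : parent root = root
  reaches_root : ∀ v, ∃ k, parent^[k] v = root

namespace RTree

variable {α : Type*}

/-- `u` is a (weak) ancestor of `v` in `T`. -/
def ancestor (T : RTree α) (u v : α) : Prop := ∃ k, T.parent^[k] v = u

/-- `u` is a proper ancestor of `v` in `T`. -/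
def properAncestor (T : RTree α) (u v : α) : Prop := T.ancestor u v ∧ u ≠ v

/-- The node set of the subtree `T_v` of `T` rooted at `v`,
i.e. `v` together with all of its descendants. -/
def subtree (T : RTree α) (v : α) : Set α := {u | T.ancestor v u}

/-- A leaf of `T` is a node with no children. -/
def IsLeaf (T : RTree α) (v : α) : Prop := ∀ u, T.parent u = v → u = v

end RTree

/-- `T` is an elimination tree on the (connected) graph `G`: every subtree of `T` induces a
connected subgraph of `G`, and every edge of `G` joins an ancestor-descendant pair of `T`.
(For connected `G` this is equivalent to the recursive definition: some vertex `r` is the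
root, and the child subtrees of `r` are elimination trees on the components of `G − r`.) -/
def IsElimTree {α : Type*} (G : SimpleGraph α) (T : RTree α) : Prop :=
  (∀ v : α, (G.induce (T.subtree v)).Connected) ∧
  (∀ u v : α, G.Adj u v → T.ancestor u v ∨ T.ancestor v u)

/-- `T` is the Cartesian tree `Ind(G,p)`: the (unique) elimination tree on `G` in which
`p(u) < p(v)` whenever `u` is a proper ancestor of `v`. -/
def IsCartesianTree {α : Type*} (G : SimpleGraph α) (p : α → ℝ) (T : RTree α) : Prop :=
  IsElimTree G T ∧ ∀ u v : α, T.properAncestor u v → p u < p v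

/-- `T` is a rooting of the tree `G`: the parent-child pairs of `T` are exactly the edges
of `G`. -/
def IsRooting {α : Type*} (G : SimpleGraph α) (T : RTree α) : Prop :=
  ∀ u v : α, G.Adj u v ↔ ((T.parent u = v ∧ u ≠ v) ∨ (T.parent v = u ∧ v ≠ u))

/-- `p` is a `T`-monotone priority function: `p` is injective and `p(v) < p(u)` whenever
`u` is a proper ancestor of `v` in `T`. -/
def IsMonotonePriority {α : Type*} (T : RTree α) (p : α → ℝ) : Prop :=
  Function.Injective p ∧ ∀ u v : α, T.properAncestor u v → p v < p u

namespace RTree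

variable {α : Type*}

theorem ancestor_refl (T : RTree α) (v : α) : T.ancestor v v := ⟨0, rfl⟩

theorem ancestor_parent (T : RTree α) (v : α) : T.ancestor (T.parent v) v := ⟨1, rfl⟩

theorem ancestor.trans {T : RTree α} {u v w : α} (huv : T.ancestor u v) (hvw : T.ancestor v w) :
    T.ancestor u w := by
  obtain ⟨k, rfl⟩ := huv
  obtain ⟨l, rfl⟩ := hvw
  exact ⟨k + l, Function.iterate_add_apply _ _ _ _⟩

/-- The ancestors of a node form a chain. -/
theorem ancestor.total {T : RTree α} {u v w : α} (hu : T.ancestor u w) (hv : T.ancestor v w) :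
    T.ancestor u v ∨ T.ancestor v u := by
  obtain ⟨k, rfl⟩ := hu
  obtain ⟨l, rfl⟩ := hv
  rcases le_total k l with h | h
  · exact Or.inr ⟨l - k, by rw [← Function.iterate_add_apply, Nat.sub_add_cancel h]⟩
  · exact Or.inl ⟨k - l, by rw [← Function.iterate_add_apply, Nat.sub_add_cancel h]⟩

/-- Induction from the root of a rooted tree towards its leaves. -/
theorem root_induction (T : RTree α) {motive : α → Prop} (root : motive T.root)
    (step : ∀ v, T.parent v ≠ v → motive (T.parent v) → motive v) (v : α) : motive v := by
  obtain ⟨k, hk⟩ := T.reaches_root v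
  induction k generalizing v with
  | zero => exact (show v = T.root from hk) ▸ root
  | succ k ih =>
    have h := ih (T.parent v) hk
    by_cases hv : T.parent v = v
    · exact hv ▸ h
    · exact step v hv h

end RTree

theorem IsMonotonePriority.le_parent {α : Type*} {T : RTree α} {p : α → ℝ}
    (hp : IsMonotonePriority T p) (v : α) : p v ≤ p (T.parent v) := by
  by_cases hv : T.parent v = v
  · rw [hv]
  · exact (hp.2 _ _ ⟨T.ancestor_parent v, hv⟩).le

/-- If `G` contains the edges of `T` and `p` is `T`-monotone, then the Cartesian tree `Ind(G,p)`
is the path in which the nodes appear in increasing order of priority. -/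
theorem isCartesianTree_iff_ancestor_iff_le {α : Type*} {G : SimpleGraph α} {T : RTree α}
    (hG : ∀ v, T.parent v ≠ v → G.Adj v (T.parent v)) {p : α → ℝ}
    (hp : IsMonotonePriority T p) (S : RTree α) :
    IsCartesianTree G p S ↔ ∀ u v : α, S.ancestor u v ↔ p u ≤ p v := by
  constructor
  · rintro ⟨⟨-, hadj⟩, hlt⟩
    have hle : ∀ u v, S.ancestor u v → p u ≤ p v := by
      intro u v h
      by_cases huv : u = v
      · rw [huv]
      · exact (hlt u v ⟨h, huv⟩).le
    have hroot : ∀ v, S.ancestor v T.root := by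
      refine T.root_induction (S.ancestor_refl _) fun v hv ih => ?_
      rcases hadj _ _ (hG v hv) with h | h
      · exact h.trans ih
      · exact absurd (hp.1 ((hle _ _ h).antisymm (hp.le_parent v))) hv
    refine fun u v => ⟨hle u v, fun h => ?_⟩
    rcases (hroot u).total (hroot v) with huv | hvu
    · exact huv
    · rw [hp.1 (h.antisymm (hle _ _ hvu))]
      exact S.ancestor_refl v
  · intro hS
    refine ⟨⟨fun v => ?_, fun u v _ => ?_⟩, fun u v h => ?_⟩
    · have hle_root : ∀ u, p u ≤ p T.root :=
        T.root_induction le_rfl fun u _ ih => (hp.le_parent u).trans ih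
      have hmem : ∀ u, u ∈ S.subtree v ↔ p v ≤ p u := hS v
      have hreach : ∀ u (hu : u ∈ S.subtree v), (G.induce (S.subtree v)).Reachable ⟨u, hu⟩
          ⟨T.root, (hmem _).2 (hle_root v)⟩ := by
        refine T.root_induction (fun _ => .rfl) fun u hu ih hmu => ?_
        have hadj : (G.induce (S.subtree v)).Adj ⟨u, hmu⟩
            ⟨T.parent u, (hmem _).2 (((hmem u).1 hmu).trans (hp.le_parent u))⟩ := hG u hu
        exact hadj.reachable.trans (ih _)
      exact SimpleGraph.connected_iff_exists_forall_reachable _ |>.2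
        ⟨_, fun u => (hreach u u.2).symm⟩
    · simpa only [hS] using le_total (p u) (p v)
    · exact lt_of_le_of_ne ((hS u v).1 h.1) fun h_eq => h.2 (hp.1 h_eq)

/-- Let `H` be a spanning tree of a connected graph `G` and `T` a rooting of `H`. Then for
every `T`-monotone priority function `p`, `Ind(G,p) = Ind(H,p)`. -/
theorem cartesianTree_spanningTree_of_monotone {α : Type*} [Fintype α]
    (G H : SimpleGraph α) (hG : G.Connected) (hHG : H ≤ G) (hH : H.IsTree)
    (T : RTree α) (hT : IsRooting H T)
    (p : α → ℝ) (hp : IsMonotonePriority T p) :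
    ∀ S : RTree α, IsCartesianTree G p S ↔ IsCartesianTree H p S := by
  have hadj : ∀ v, T.parent v ≠ v → H.Adj v (T.parent v) := fun v hv =>
    (hT v (T.parent v)).2 (Or.inl ⟨rfl, hv.symm⟩)
  intro S
  rw [isCartesianTree_iff_ancestor_iff_le (fun v hv => hHG (hadj v hv)) hp,
    isCartesianTree_iff_ancestor_iff_le hadj hp]
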